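/- arXiv:2507.09388 — 3 statements merged into one kernel-verified Lean document; each statement's English description precedes it below -/
import Mathlib

section
/- Under the parametric pairwise-comparison model with link F satisfying (A1), suppose p ≥ c log n/n for a sufficiently large constant c > 0. Then P( ‖∇L(θ*)‖₂ ≤ 3κ₁ √(n² p log n) ) ≥ 1 − O(n^{−10}), where ∇L(θ*) = Σ_{(i,j)∈G} (F(θ*_i−θ*_j) − y_{ij}) · F′(θ*_i−θ*_j)/(F(θ*_i−θ*_j)(1−F(θ*_i−θ*_j))) · (e_i − e_j) is the gradient of the negative log-likelihood at the true parameter. -/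
open MeasureTheory ProbabilityTheory
open scoped ENNReal

namespace PrivateRanking

instance : MeasurableSpace (Option Bool) := ⊤

/-- The index set of potential comparisons: ordered pairs `(i, j)` with `i < j`. -/
abbrev Pair (n : ℕ) := {q : Fin n × Fin n // q.1 < q.2}

/-- A dataset of pairwise comparisons: for each pair `(i,j)` with `i < j`, either `none`
(the pair was not compared) or `some b`, where `b = true` iff item `i` beat item `j`. -/
abbrev EdgeData (n : ℕ) := Pair n → Option Bool

/-- Edge adjacency: either the comparison graphs are identical and exactly one comparison
outcome differs, or the graphs differ by exactly one edge and all outcomes on common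
edges agree. -/
def EdgeAdjacent {n : ℕ} (d d' : EdgeData n) : Prop :=
  (∃ q, (d q).isSome ∧ (d' q).isSome ∧ d q ≠ d' q ∧ ∀ r, r ≠ q → d r = d' r) ∨
  (∃ q₁ q₂, q₁ ≠ q₂ ∧ (d q₁).isSome ∧ d' q₁ = none ∧ d q₂ = none ∧ (d' q₂).isSome ∧
    ∀ r, r ≠ q₁ → r ≠ q₂ → d r = d' r)

/-- Contribution of a single observed comparison with outcome `b` to the negative
log-likelihood: `-y log F - (1-y) log (1-F)`. -/
noncomputable def nllTerm (F : ℝ → ℝ) (x : ℝ) (b : Bool) : ℝ :=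
  if b then -Real.log (F x) else -Real.log (1 - F x)

/-- The negative log-likelihood `L(θ; y)` of the comparison data `d`. -/
noncomputable def nll (n : ℕ) (F : ℝ → ℝ) (θ : Fin n → ℝ) (d : EdgeData n) : ℝ :=
  ∑ q : Pair n, (d q).elim 0 (fun b => nllTerm F (θ q.1.1 - θ q.1.2) b)

/-- The perturbed and ridge-regularized objective
`L(θ; y) + (γ/2)‖θ‖₂² + wᵀθ`. -/
noncomputable def pobj (n : ℕ) (F : ℝ → ℝ) (γ : ℝ) (w : Fin n → ℝ) (d : EdgeData n)
    (θ : Fin n → ℝ) : ℝ :=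
  nll n F θ d + γ / 2 * ∑ i, θ i ^ 2 + ∑ i, w i * θ i

/-- The Laplace distribution with scale `b`, via its density `(2b)⁻¹ exp (-|x|/b)`. -/
noncomputable def laplaceMeasure (b : ℝ) : Measure ℝ :=
  volume.withDensity fun x => ENNReal.ofReal ((2 * b)⁻¹ * Real.exp (-|x| / b))

/-- The law of `n` i.i.d. Laplace(b) random variables. -/
noncomputable def laplacePi (n : ℕ) (b : ℝ) : Measure (Fin n → ℝ) :=
  Measure.pi fun _ => laplaceMeasure b

/-- (A0): `F` is strictly increasing and symmetric, `F x = 1 - F (-x)`. -/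
def CondA0 (F : ℝ → ℝ) : Prop := StrictMono F ∧ ∀ x, F x = 1 - F (-x)

/-- (A1): `sup_x |F'(x)/(F(x)(1-F(x)))| < κ₁`. -/
def CondA1 (F : ℝ → ℝ) (κ₁ : ℝ) : Prop :=
  0 < κ₁ ∧ Differentiable ℝ F ∧ ∀ x, |deriv F x / (F x * (1 - F x))| < κ₁

/-- (A2): `(-log F)'' > 0` everywhere, `(-log F)'' < κ₂`, and
`(-log F)'' > 1/κ₂` on `[-4, 4]`. -/
def CondA2 (F : ℝ → ℝ) (κ₂ : ℝ) : Prop :=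
  0 < κ₂ ∧ (∀ x, 0 < deriv (deriv fun y => -Real.log (F y)) x) ∧
    (∀ x, deriv (deriv fun y => -Real.log (F y)) x < κ₂) ∧
    (∀ x, |x| ≤ 4 → κ₂⁻¹ < deriv (deriv fun y => -Real.log (F y)) x)

/-- Probability weight of a single pair's observation under sampling probability `p`,
when the lower-indexed item wins with probability `ρwin`. -/
noncomputable def pairWeight (p ρwin : ℝ) : Option Bool → ℝ
  | none => 1 - p
  | some true => p * ρwin
  | some false => p * (1 - ρwin)

/-- `data : Ω → EdgeData n` follows the parametric pairwise-comparison model: each pair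
`(i,j)`, `i<j`, is observed independently with probability `p`, and an observed pair is
won by `i` with probability `F(θ i - θ j)`, independently across pairs. -/
def IsParamModel {Ω : Type*} [MeasurableSpace Ω] (μ : Measure Ω) (n : ℕ) (p : ℝ)
    (F : ℝ → ℝ) (θ : Fin n → ℝ) (data : Ω → EdgeData n) : Prop :=
  Measurable data ∧
    ∀ d : EdgeData n, μ {ω | data ω = d} =
      ∏ q : Pair n, ENNReal.ofReal (pairWeight p (F (θ q.1.1 - θ q.1.2)) (d q))

/-- `W : Ω → Fin n → ℝ` is an i.i.d. Laplace(b) noise vector. -/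
def IsLaplaceNoise {Ω : Type*} [MeasurableSpace Ω] (μ : Measure Ω) (n : ℕ) (b : ℝ)
    (W : Ω → Fin n → ℝ) : Prop :=
  Measurable W ∧ μ.map W = laplacePi n b

/-- The gradient of the negative log-likelihood,
`∇L(θ) = Σ_{(i,j)∈G} (F(θ_i-θ_j) - y_{ij}) F'(θ_i-θ_j)/(F(θ_i-θ_j)(1-F(θ_i-θ_j))) (e_i - e_j)`. -/
noncomputable def gradNll (n : ℕ) (F : ℝ → ℝ) (θ : Fin n → ℝ) (d : EdgeData n) :
    Fin n → ℝ := fun a =>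
  ∑ q : Pair n, (d q).elim 0 (fun b =>
    (F (θ q.1.1 - θ q.1.2) - (if b then 1 else 0)) *
      (deriv F (θ q.1.1 - θ q.1.2) /
        (F (θ q.1.1 - θ q.1.2) * (1 - F (θ q.1.1 - θ q.1.2)))) *
      ((if q.1.1 = a then (1 : ℝ) else 0) - (if q.1.2 = a then (1 : ℝ) else 0)))

lemma aux_exp (x : ℝ) (hx : |x| ≤ 1) : Real.exp x ≤ 1 + x + 3 / 4 * x ^ 2 := by
  have h := Real.exp_bound hx (n := 3) (by norm_num)
  simp [Finset.sum_range_succ, Nat.factorial] at h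
  have h1 := (abs_le.1 h).2
  have h2 : |x| ^ 3 ≤ x ^ 2 := by
    rw [pow_succ, sq_abs]
    nlinarith [sq_nonneg x]
  nlinarith [sq_nonneg x]

lemma aux_factor (p f r : ℝ) (hp : 0 ≤ p) (hf0 : 0 ≤ f) (hf1 : f ≤ 1) (hr : |r| ≤ 1) :
    (1 - p) + p * f * Real.exp (r * (f - 1)) + p * (1 - f) * Real.exp (r * f)
      ≤ Real.exp (p * (3 / 16) * r ^ 2) := by
  have h1 : |r * (f - 1)| ≤ 1 := by
    rw [abs_mul]
    have : |f - 1| ≤ 1 := abs_le.2 ⟨by linarith, by linarith⟩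
    exact mul_le_one₀ hr (abs_nonneg _) this
  have h2 : |r * f| ≤ 1 := by
    rw [abs_mul]
    have : |f| ≤ 1 := abs_le.2 ⟨by linarith, by linarith⟩
    exact mul_le_one₀ hr (abs_nonneg _) this
  have e1 := mul_le_mul_of_nonneg_left (aux_exp _ h1) (mul_nonneg hp hf0)
  have e2 := mul_le_mul_of_nonneg_left (aux_exp _ h2) (mul_nonneg hp (by linarith : 0 ≤ 1 - f))
  have e3 : p * r ^ 2 * (f * (1 - f)) ≤ p * r ^ 2 * (1 / 4) :=
    mul_le_mul_of_nonneg_left (by nlinarith [sq_nonneg (f - 1 / 2)]) (by positivity)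
  have e4 := Real.add_one_le_exp (p * (3 / 16) * r ^ 2)
  nlinarith

lemma aux_markov {ι : Type*} [Fintype ι] [DecidableEq ι] (w x : ι → Option Bool → ℝ)
    (hw : ∀ q o, 0 ≤ w q o) (T : ℝ) :
    ∑ d : ι → Option Bool, (if T ≤ ∑ q, x q (d q) then ∏ q, w q (d q) else 0) ≤
      Real.exp (-T) * ∏ q, ∑ o, w q o * Real.exp (x q o) := by
  rw [Fintype.prod_sum, Finset.mul_sum]
  refine Finset.sum_le_sum fun d _ => ?_
  rw [Finset.prod_mul_distrib, ← Real.exp_sum]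
  have hW : 0 ≤ ∏ q, w q (d q) := Finset.prod_nonneg fun q _ => hw _ _
  split_ifs with h
  · have : 1 ≤ Real.exp (-T) * Real.exp (∑ q, x q (d q)) := by
      rw [← Real.exp_add]; exact Real.one_le_exp (by linarith)
    nlinarith
  · positivity

lemma aux_count (n : ℕ) (a : Fin n) :
    ∑ q : Pair n, ((if q.1.1 = a then (1 : ℝ) else 0) - (if q.1.2 = a then (1 : ℝ) else 0)) ^ 2
      ≤ n := by
  have h : ∀ q : Pair n,
      ((if q.1.1 = a then (1 : ℝ) else 0) - (if q.1.2 = a then (1 : ℝ) else 0)) ^ 2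
        = if q.1.1 = a ∨ q.1.2 = a then 1 else 0 := by
    rintro ⟨⟨i, j⟩, hij⟩
    have hne : i ≠ j := ne_of_lt hij
    by_cases h1 : i = a <;> by_cases h2 : j = a
    · exact absurd (h1.trans h2.symm) hne
    · simp [h1, h2]
    · simp [h1, h2]
    · simp [h1, h2]
  simp_rw [h]
  rw [Finset.sum_boole]
  norm_cast
  calc _ ≤ (Finset.univ : Finset (Fin n)).card := by
        refine Finset.card_le_card_of_injOn (fun q => if q.1.1 = a then q.1.2 else q.1.1)
          (fun _ _ => by simp) ?_
        rintro ⟨⟨i, j⟩, hij⟩ h1 ⟨⟨k, l⟩, hkl⟩ h2 h3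
        simp only [Finset.coe_filter, Finset.mem_univ, true_and, Set.mem_ofPred_eq] at h1 h2 h3 hij hkl
        simp only [Subtype.mk.injEq, Prod.mk.injEq]
        split_ifs at h3 <;> grind
    _ = n := by simp

lemma aux_msc (n : ℕ) : MeasurableSingletonClass (EdgeData n) := by
  have : MeasurableSingletonClass (Option Bool) := ⟨fun _ => trivial⟩
  infer_instance

lemma aux_total {Ω : Type} [MeasurableSpace Ω] (μ : Measure Ω) [IsProbabilityMeasure μ]
    (n : ℕ) (p : ℝ) (F : ℝ → ℝ) (θ : Fin n → ℝ) (data : Ω → EdgeData n)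
    (h : IsParamModel μ n p F θ data) :
    ∏ q : Pair n, ∑ o, ENNReal.ofReal (pairWeight p (F (θ q.1.1 - θ q.1.2)) o) = 1 := by
  have := aux_msc n
  rw [Fintype.prod_sum]
  simp_rw [← h.2]
  have := sum_measure_preimage_singleton (μ := μ) (f := data) Finset.univ
    (fun y _ => h.1 (measurableSet_singleton y))
  simp only [Finset.coe_univ, Set.preimage_univ, measure_univ] at this
  exact this

lemma aux_F {Ω : Type} [MeasurableSpace Ω] (μ : Measure Ω) [IsProbabilityMeasure μ]
    (n : ℕ) (p : ℝ) (hp : 0 < p) (hp1 : p ≤ 1) (F : ℝ → ℝ) (θ : Fin n → ℝ)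
    (data : Ω → EdgeData n)
    (h : IsParamModel μ n p F θ data) (q : Pair n) :
    0 ≤ F (θ q.1.1 - θ q.1.2) ∧ F (θ q.1.1 - θ q.1.2) ≤ 1 := by
  have ht := aux_total μ n p F θ data h
  have hs : ∀ f : ℝ, ∑ o, ENNReal.ofReal (pairWeight p f o) =
      ENNReal.ofReal (1 - p) + (ENNReal.ofReal (p * f) + ENNReal.ofReal (p * (1 - f))) := by
    intro f; simp [Fintype.sum_option, pairWeight]
  have h1 : ∀ f : ℝ, 1 ≤ ∑ o, ENNReal.ofReal (pairWeight p f o) := by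
    intro f
    rw [hs]
    calc (1 : ℝ≥0∞) = ENNReal.ofReal ((1 - p) + (p * f + p * (1 - f))) := by
          rw [← ENNReal.ofReal_one]; congr 1; ring
      _ ≤ _ := ENNReal.ofReal_add_le.trans (by gcongr; exact ENNReal.ofReal_add_le)
  have h2 : ∑ o, ENNReal.ofReal (pairWeight p (F (θ q.1.1 - θ q.1.2)) o) ≤ 1 := by
    rw [← ht]
    exact Finset.single_le_prod' (f := fun q : Pair n =>
      ∑ o, ENNReal.ofReal (pairWeight p (F (θ q.1.1 - θ q.1.2)) o)) (fun _ _ => h1 _)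
      (Finset.mem_univ q)
  rw [hs] at h2
  set f := F (θ q.1.1 - θ q.1.2)
  have h3 : ∀ x y : ℝ, 0 ≤ x → 0 ≤ y → ENNReal.ofReal x + ENNReal.ofReal y ≤ 1 → x + y ≤ 1 := by
    intro x y hx hy hxy
    rw [← ENNReal.ofReal_add hx hy] at hxy
    exact ENNReal.ofReal_le_one.1 hxy
  constructor
  · by_contra hf
    push Not at hf
    have := h3 (1 - p) (p * (1 - f)) (by linarith) (by nlinarith)
      (le_trans (by gcongr; exact le_add_self) h2)
    nlinarith
  · by_contra hf
    push Not at hf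
    have := h3 (1 - p) (p * f) (by linarith) (by nlinarith)
      (le_trans (by gcongr; exact le_self_add) h2)
    nlinarith

lemma aux_prob {Ω : Type} [MeasurableSpace Ω] (μ : Measure Ω) [IsProbabilityMeasure μ]
    (n : ℕ) (p : ℝ) (hp : 0 < p) (hp1 : p ≤ 1) (F : ℝ → ℝ) (θ : Fin n → ℝ)
    (data : Ω → EdgeData n) (h : IsParamModel μ n p F θ data)
    (κ : ℝ) (hA : CondA1 F κ) (a : Fin n) (s T : ℝ) (hs : |s| * κ ≤ 1) :
    μ {ω | T ≤ s * gradNll n F θ (data ω) a} ≤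
      ENNReal.ofReal (Real.exp (-T + n * (p * (3 / 16) * (s ^ 2 * κ ^ 2)))) := by
  classical
  obtain ⟨hκ, -, hA⟩ := hA
  have hF := aux_F μ n p hp hp1 F θ data h
  set w : Pair n → Option Bool → ℝ := fun q o => pairWeight p (F (θ q.1.1 - θ q.1.2)) o with hw
  have hw0 : ∀ q o, 0 ≤ w q o := by
    intro q o
    obtain ⟨h0, h1⟩ := hF q
    rcases o with _ | _ | _ <;> simp only [hw, pairWeight]
    · linarith
    · exact mul_nonneg hp.le (by linarith)
    · exact mul_nonneg hp.le h0
  set v : Pair n → ℝ := fun q =>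
    ((if q.1.1 = a then (1 : ℝ) else 0) - (if q.1.2 = a then (1 : ℝ) else 0)) with hv
  set x : Pair n → Option Bool → ℝ := fun q o => s * o.elim 0 (fun b =>
    (F (θ q.1.1 - θ q.1.2) - (if b then 1 else 0)) *
      (deriv F (θ q.1.1 - θ q.1.2) /
        (F (θ q.1.1 - θ q.1.2) * (1 - F (θ q.1.1 - θ q.1.2)))) * v q) with hx
  have hg : ∀ d : EdgeData n, s * gradNll n F θ d a = ∑ q, x q (d q) := by
    intro d
    simp only [gradNll, hx, Finset.mul_sum, hv]
  have hfac : ∀ q, ∑ o, w q o * Real.exp (x q o) ≤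
      Real.exp ((p * (3 / 16) * (s ^ 2 * κ ^ 2)) * v q ^ 2) := by
    intro q
    obtain ⟨h0, h1⟩ := hF q
    have hgq := hA (θ q.1.1 - θ q.1.2)
    have hvq : |v q| ≤ 1 := by
      simp only [hv]; split_ifs <;> norm_num
    simp only [Fintype.sum_option, Fintype.sum_bool, hx, hw, pairWeight, Option.elim]
    set g := deriv F (θ q.1.1 - θ q.1.2) /
        (F (θ q.1.1 - θ q.1.2) * (1 - F (θ q.1.1 - θ q.1.2)))
    set f := F (θ q.1.1 - θ q.1.2)
    have hr : |s * g * v q| ≤ 1 := by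
      rw [abs_mul, abs_mul]
      refine mul_le_one₀ (le_trans ?_ hs) (abs_nonneg _) hvq
      gcongr
    have := aux_factor p f (s * g * v q) hp.le h0 h1 hr
    have hgk : g ^ 2 ≤ κ ^ 2 := by
      rw [← sq_abs g]; gcongr
    calc _ = (1 - p) + p * f * Real.exp (s * g * v q * (f - 1))
          + p * (1 - f) * Real.exp (s * g * v q * f) := by
          simp; ring_nf
      _ ≤ _ := this
      _ ≤ _ := by
        apply Real.exp_le_exp.2
        have : (s * g * v q) ^ 2 = s ^ 2 * g ^ 2 * v q ^ 2 := by ring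
        rw [this, mul_assoc (p * (3 / 16)) (s ^ 2 * κ ^ 2)]
        gcongr
  calc μ {ω | T ≤ s * gradNll n F θ (data ω) a}
      ≤ ∑ d : EdgeData n, (if T ≤ ∑ q, x q (d q) then μ {ω | data ω = d} else 0) := by
        rw [← Finset.sum_filter]
        refine le_trans (measure_mono ?_) (measure_biUnion_finset_le _ _)
        intro ω hω
        simp only [Set.mem_ofPred_eq, hg] at hω
        simp only [Finset.mem_filter, Finset.mem_univ, true_and, Set.mem_iUnion, Set.mem_ofPred_eq]
        exact ⟨data ω, hω, rfl⟩
    _ = ENNReal.ofReal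
        (∑ d : EdgeData n, (if T ≤ ∑ q, x q (d q) then ∏ q, w q (d q) else 0)) := by
        rw [ENNReal.ofReal_sum_of_nonneg]
        · refine Finset.sum_congr rfl fun d _ => ?_
          split_ifs
          · rw [h.2, ENNReal.ofReal_prod_of_nonneg (fun q _ => hw0 _ _)]
          · simp
        · intro d _
          split_ifs
          · exact Finset.prod_nonneg fun q _ => hw0 _ _
          · exact le_rfl
    _ ≤ _ := by
        apply ENNReal.ofReal_le_ofReal
        refine (aux_markov w x hw0 T).trans ?_
        rw [Real.exp_add]
        gcongr
        calc _ ≤ ∏ q, Real.exp ((p * (3 / 16) * (s ^ 2 * κ ^ 2)) * v q ^ 2) :=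
              Finset.prod_le_prod
                (fun q _ => Finset.sum_nonneg fun o _ => mul_nonneg (hw0 _ _) (Real.exp_nonneg _))
                (fun q _ => hfac q)
          _ = Real.exp ((p * (3 / 16) * (s ^ 2 * κ ^ 2)) * ∑ q, v q ^ 2) := by
              rw [← Real.exp_sum, Finset.mul_sum]
          _ ≤ _ := by
              apply Real.exp_le_exp.2
              rw [mul_comm]
              gcongr
              exact aux_count n a

/-- Lemma 1: concentration of the likelihood gradient at `θ*`.
There are universal constants `c, C' > 0` such that under the parametric model with
link `F` satisfying (A1), if `p ≥ c log n / n` then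
`‖∇L(θ*)‖₂ ≤ 3κ₁ √(n² p log n)` except with probability at most `C' n⁻¹⁰`. -/
theorem statement15 : ∃ c C' : ℝ, 0 < c ∧ 0 < C' ∧
    ∀ (n : ℕ) (F : ℝ → ℝ) (κ₁ p : ℝ) (θstar : Fin n → ℝ),
      CondA1 F κ₁ → 0 < p → p ≤ 1 →
      c * Real.log n / n ≤ p →
    ∀ (Ω : Type) (_ : MeasurableSpace Ω) (μ : Measure Ω), IsProbabilityMeasure μ →
    ∀ data : Ω → EdgeData n, IsParamModel μ n p F θstar data →
      μ {ω | ¬ Real.sqrt (∑ a, (gradNll n F θstar (data ω) a) ^ 2) ≤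
          3 * κ₁ * Real.sqrt ((n : ℝ) ^ 2 * p * Real.log n)} ≤
        ENNReal.ofReal (C' / n ^ 10) := by
  refine ⟨64, 2, by norm_num, by norm_num, ?_⟩
  intro n F κ p θ hA hp hp1 hc Ω _ μ hμ data h
  rcases Nat.eq_zero_or_pos n with rfl | hn
  · simp
  have hn0 : (0 : ℝ) < n := by exact_mod_cast hn
  have hn1 : (1 : ℝ) ≤ n := by exact_mod_cast hn
  have hκ : 0 < κ := hA.1
  set L := Real.log n with hL
  have hL0 : 0 ≤ L := Real.log_nonneg hn1
  have hnp : 0 < n * p := by positivity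
  have hLc : 64 * L ≤ n * p := by
    rw [div_le_iff₀ hn0] at hc; linarith
  set R := Real.sqrt (n * p * L) with hR
  have hR0 : 0 ≤ R := Real.sqrt_nonneg _
  have hR2 : R ^ 2 = n * p * L := Real.sq_sqrt (by positivity)
  set t := 3 * κ * R with ht
  have ht0 : 0 ≤ t := by positivity
  set s := 8 * R / (n * p * κ) with hs
  have hs0 : 0 ≤ s := by positivity
  have hsκ : s * κ ≤ 1 := by
    have : s * κ = 8 * R / (n * p) := by rw [hs]; field_simp
    rw [this, div_le_one hnp]
    apply le_of_sq_le_sq _ hnp.le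
    nlinarith
  have hst : s * t = 24 * L := by
    have : s * t = 24 * R ^ 2 / (n * p) := by rw [hs, ht]; field_simp; ring
    rw [this, hR2]; field_simp
  have hexp : -(s * t) + n * (p * (3 / 16) * (s ^ 2 * κ ^ 2)) = -(12 * L) := by
    have : n * (p * (3 / 16) * (s ^ 2 * κ ^ 2)) = 12 * R ^ 2 / (n * p) := by
      rw [hs]; field_simp; ring
    rw [this, hst, hR2]; field_simp; ring
  have hE : Real.exp (-(12 * L)) = 1 / (n : ℝ) ^ 12 := by
    rw [Real.exp_neg, hL, mul_comm, Real.exp_mul, Real.exp_log hn0, one_div]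
    norm_cast
  have hP1 : ∀ a, μ {ω | s * t ≤ s * gradNll n F θ (data ω) a} ≤
      ENNReal.ofReal (1 / (n : ℝ) ^ 12) := by
    intro a
    have := aux_prob μ n p hp hp1 F θ data h κ hA a s (s * t) (by rwa [abs_of_nonneg hs0])
    rwa [hexp, hE] at this
  have hP2 : ∀ a, μ {ω | s * t ≤ (-s) * gradNll n F θ (data ω) a} ≤
      ENNReal.ofReal (1 / (n : ℝ) ^ 12) := by
    intro a
    have := aux_prob μ n p hp hp1 F θ data h κ hA a (-s) (s * t)
      (by rwa [abs_neg, abs_of_nonneg hs0])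
    rwa [neg_sq, hexp, hE] at this
  calc _ ≤ μ (⋃ a ∈ (Finset.univ : Finset (Fin n)),
        ({ω | s * t ≤ s * gradNll n F θ (data ω) a} ∪
          {ω | s * t ≤ (-s) * gradNll n F θ (data ω) a})) := by
        apply measure_mono
        intro ω hω
        by_contra hcon
        apply hω
        simp only [Set.mem_iUnion, Finset.mem_univ, Set.mem_union, Set.mem_ofPred_eq, exists_prop,
          true_and, not_exists, not_or, not_le] at hcon
        have hb : ∀ a, gradNll n F θ (data ω) a ^ 2 ≤ t ^ 2 := by
          intro a
          obtain ⟨h1, h2⟩ := hcon a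
          apply sq_le_sq'
          · nlinarith
          · nlinarith
        have hsum : ∑ a, gradNll n F θ (data ω) a ^ 2 ≤ n * t ^ 2 := by
          calc _ ≤ ∑ a : Fin n, t ^ 2 := Finset.sum_le_sum fun a _ => hb a
            _ = _ := by simp
        apply Real.sqrt_le_iff.2
        refine ⟨by positivity, hsum.trans (le_of_eq ?_)⟩
        rw [ht, mul_pow, mul_pow (3 * κ) (√_), hR2, Real.sq_sqrt (by positivity)]
        ring
    _ ≤ ∑ a : Fin n, (ENNReal.ofReal (1 / (n : ℝ) ^ 12) + ENNReal.ofReal (1 / (n : ℝ) ^ 12)) :=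
        (measure_biUnion_finset_le _ _).trans (Finset.sum_le_sum fun a _ =>
          (measure_union_le _ _).trans (add_le_add (hP1 a) (hP2 a)))
    _ = ENNReal.ofReal (n * (1 / (n : ℝ) ^ 12 + 1 / (n : ℝ) ^ 12)) := by
        rw [← ENNReal.ofReal_add (by positivity) (by positivity), ENNReal.ofReal_mul hn0.le]
        simp
    _ ≤ _ := by
        apply ENNReal.ofReal_le_ofReal
        rw [le_div_iff₀ (by positivity)]
        have : n * (1 / (n : ℝ) ^ 12 + 1 / (n : ℝ) ^ 12) * n ^ 10 = 2 / n := by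
          field_simp; ring
        rw [this]
        exact div_le_self (by norm_num) hn1


end PrivateRanking
end

section
/- Under the parametric pairwise-comparison model with link F satisfying (A0) and (A2), and with ‖θ*‖_∞ ≤ 1, condition on the event A₀ = {np/2 ≤ d_min(G) ≤ d_max(G) ≤ 3np/2} (where d_min and d_max are the minimum and maximum degrees of the comparison graph G) and suppose p ≳ log n/n. Then with probability at least 1 − O(n^{−10}), simultaneously for all v ∈ ℝⁿ with ‖v − θ*‖_∞ ≤ 1: np/(2κ₂) ≤ λ₂(∇²L(v)) ≤ λ_max(∇²L(v)) ≤ 3κ₂ np, where λ₂ and λ_max denote the second-smallest and largest eigenvalues of the Hessian ∇²L(v) = Σ_{(i,j)∈G} [y_{ij}·(−log F)″(v_i−v_j) + y_{ji}·(−log(1−F))″(v_i−v_j)]·(e_i−e_j)(e_i−e_j)ᵀ. -/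
open MeasureTheory ProbabilityTheory
open scoped ENNReal

namespace PrivateRanking

/-- The degree of item `i` in the comparison graph of dataset `d`. -/
def degree {n : ℕ} (d : EdgeData n) (i : Fin n) : ℕ :=
  (Finset.univ.filter fun q : Pair n => (q.1.1 = i ∨ q.1.2 = i) ∧ (d q).isSome).card

/-- The coefficient of `(e_i - e_j)(e_i - e_j)ᵀ` in the Hessian `∇²L(v)`:
`y_{ij} (-log F)''(v_i - v_j) + y_{ji} (-log(1-F))''(v_i - v_j)`. -/
noncomputable def hessCoeff (F : ℝ → ℝ) (x : ℝ) (b : Bool) : ℝ :=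
  if b then deriv (deriv fun y => -Real.log (F y)) x
  else deriv (deriv fun y => -Real.log (1 - F y)) x

/-- The quadratic form `xᵀ ∇²L(v) x` of the Hessian of the negative log-likelihood. -/
noncomputable def hessQuad (n : ℕ) (F : ℝ → ℝ) (d : EdgeData n) (v x : Fin n → ℝ) : ℝ :=
  ∑ q : Pair n, (d q).elim 0
    (fun b => hessCoeff F (v q.1.1 - v q.1.2) b * (x q.1.1 - x q.1.2) ^ 2)

section helpers
open NormedSpace Filter Topology
set_option linter.unusedSectionVars false

section trotter
variable {𝔸 : Type*} [NormedRing 𝔸] [NormedAlgebra ℝ 𝔸] [CompleteSpace 𝔸] [NormOneClass 𝔸]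

lemma aux_norm_exp_le (x : 𝔸) : ‖exp x‖ ≤ Real.exp ‖x‖ := by
  have h := exp_series_hasSum_exp' (𝕂 := ℝ) x
  have h2 := exp_series_hasSum_exp' (𝕂 := ℝ) ‖x‖
  rw [← Real.exp_eq_exp_ℝ] at h2
  rw [← h.tsum_eq]
  refine tsum_of_norm_bounded h2 fun n => ?_
  rw [norm_smul]
  simp only [smul_eq_mul, norm_inv, RCLike.norm_natCast]
  gcongr
  exact norm_pow_le x n

lemma aux_pow_sub (X Y : 𝔸) (r : ℝ) (hX : ‖X‖ ≤ r) (hY : ‖Y‖ ≤ r) (hr : 1 ≤ r) (N : ℕ) :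
    ‖X ^ N - Y ^ N‖ ≤ N * ‖X - Y‖ * r ^ N := by
  induction N with
  | zero => simp
  | succ N ih =>
    have e : X ^ (N+1) - Y ^ (N+1) = X ^ N * (X - Y) + (X ^ N - Y ^ N) * Y := by
      rw [pow_succ, pow_succ]; noncomm_ring
    have h0 : 0 ≤ r := by linarith
    have h1 : ‖X ^ N‖ ≤ r ^ (N+1) := (norm_pow_le X N).trans
      ((pow_le_pow_left₀ (norm_nonneg _) hX N).trans (pow_le_pow_right₀ hr (by omega)))
    rw [e]
    calc _ ≤ ‖X ^ N‖ * ‖X - Y‖ + ‖X ^ N - Y ^ N‖ * ‖Y‖ :=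
          (norm_add_le _ _).trans (add_le_add (norm_mul_le _ _) (norm_mul_le _ _))
      _ ≤ r ^ (N+1) * ‖X - Y‖ + (N * ‖X - Y‖ * r ^ N) * r := by gcongr
      _ = _ := by push_cast; ring

lemma aux_trotter (A B : 𝔸) :
    Tendsto (fun N : ℕ => (exp ((N:ℝ)⁻¹ • A) * exp ((N:ℝ)⁻¹ • B)) ^ N) atTop (𝓝 (exp (A + B))) := by
  have hd : HasDerivAt (fun s : ℝ => exp (s • (A + B)) - exp (s • A) * exp (s • B)) 0 0 := by
    have h1 := hasDerivAt_exp_smul_const (𝕂 := ℝ) (A + B) (0:ℝ)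
    have h2 := hasDerivAt_exp_smul_const (𝕂 := ℝ) A (0:ℝ)
    have h3 := hasDerivAt_exp_smul_const (𝕂 := ℝ) B (0:ℝ)
    have := h1.sub (h2.mul h3)
    have e : (0 : 𝔸) = exp ((0:ℝ) • (A + B)) * (A + B) - (exp ((0:ℝ) • A) * A * exp ((0:ℝ) • B)
      + exp ((0:ℝ) • A) * (exp ((0:ℝ) • B) * B)) := by simp
    rw [e]
    exact this
  have hs : Tendsto (fun N : ℕ => (N:ℝ) • (exp ((N:ℝ)⁻¹ • (A + B))
      - exp ((N:ℝ)⁻¹ • A) * exp ((N:ℝ)⁻¹ • B))) atTop (𝓝 0) := by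
    have h1 := hasDerivAt_iff_tendsto_slope.1 hd
    have h2 : Tendsto (fun N : ℕ => (N:ℝ)⁻¹) atTop (𝓝[≠] 0) := by
      rw [tendsto_nhdsWithin_iff]
      refine ⟨tendsto_inv_atTop_nhds_zero_nat, ?_⟩
      filter_upwards [eventually_gt_atTop 0] with N hN
      simp; omega
    refine (h1.comp h2).congr fun N => ?_
    simp [slope]
  have hs' := (hs.norm.mul_const (Real.exp (‖A‖ + ‖B‖)))
  rw [norm_zero, zero_mul] at hs'
  rw [tendsto_iff_norm_sub_tendsto_zero]
  refine squeeze_zero' (Eventually.of_forall fun _ => norm_nonneg _) ?_ hs'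
  filter_upwards [eventually_gt_atTop 0] with N hN
  have hN' : (0:ℝ) < N := by exact_mod_cast hN
  have e1 : exp (A + B) = exp ((N:ℝ)⁻¹ • (A + B)) ^ N := by
    let _ : NormedAlgebra ℚ 𝔸 := NormedAlgebra.restrictScalars ℚ ℝ 𝔸
    rw [← exp_nsmul, ← Nat.cast_smul_eq_nsmul ℝ, smul_smul, mul_inv_cancel₀ hN'.ne', one_smul]
  rw [e1, norm_sub_rev]
  refine (aux_pow_sub _ _ (Real.exp ((N:ℝ)⁻¹ * (‖A‖ + ‖B‖))) ?_ ?_ ?_ N).trans ?_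
  · refine (aux_norm_exp_le _).trans (Real.exp_le_exp.2 ?_)
    rw [norm_smul, Real.norm_of_nonneg (by positivity)]
    gcongr; exact norm_add_le _ _
  · refine (norm_mul_le _ _).trans ?_
    rw [mul_add, Real.exp_add]
    gcongr <;> refine (aux_norm_exp_le _).trans (Real.exp_le_exp.2 ?_) <;>
    rw [norm_smul, Real.norm_of_nonneg (by positivity)]
  · exact Real.one_le_exp (by positivity)
  · rw [← Real.exp_nat_mul, norm_smul, Real.norm_of_nonneg hN'.le, ← mul_assoc, mul_inv_cancel₀ hN'.ne', one_mul]
end trotter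

section GT
open Matrix
variable {m : Type*} [Fintype m] [DecidableEq m]

lemma aux_trace_mul_le (A B : Matrix m m ℝ) :
    2 * trace (A * B) ≤ trace (A * Aᵀ) + trace (Bᵀ * B) := by
  simp only [trace, diag_apply, mul_apply, transpose_apply]
  have : ∑ i, ∑ j, B j i * B j i = ∑ i, ∑ j, B i j * B i j := by
    rw [Finset.sum_comm]
  have h2 : ∑ i, ∑ j, B j i * B j i = ∑ i, ∑ j, B j i * B j i := rfl
  rw [Finset.mul_sum, ← Finset.sum_add_distrib]
  refine Finset.sum_le_sum fun i _ => ?_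
  rw [Finset.mul_sum, ← Finset.sum_add_distrib]
  refine Finset.sum_le_sum fun j _ => ?_
  nlinarith [sq_nonneg (A i j - B j i)]

lemma aux_trace_pow_mul (A B : Matrix m m ℝ) (k : ℕ) :
    trace ((A * B) ^ k) = trace ((B * A) ^ k) := by
  cases k with
  | zero => simp
  | succ k =>
    have : (A * B) ^ (k+1) = A * ((B * A) ^ k * B) := by
      induction k with
      | zero => simp
      | succ k ih => rw [pow_succ', ih, pow_succ']; simp only [mul_assoc]
    rw [this, trace_mul_comm, mul_assoc, ← pow_succ]

lemma aux_PR (k : ℕ) :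
    (∀ M : Matrix m m ℝ, trace (M ^ 2 ^ (k+1)) ≤ trace ((M * Mᵀ) ^ 2 ^ k)) ∧
    (∀ P Q : Matrix m m ℝ, Pᵀ = P → Qᵀ = Q →
      trace ((P * Q) ^ 2 ^ k) ≤ trace (P ^ 2 ^ k * Q ^ 2 ^ k)) := by
  induction k with
  | zero =>
    refine ⟨fun M => ?_, fun P Q _ _ => by simp⟩
    have := aux_trace_mul_le M M
    rw [trace_mul_comm Mᵀ] at this
    simp only [zero_add, pow_one, pow_zero, pow_two]
    linarith
  | succ k ih =>
    obtain ⟨ihP, ihR⟩ := ih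
    constructor
    · intro M
      have e1 : M ^ 2 ^ (k+1+1) = (M ^ 2) ^ 2 ^ (k+1) := by rw [← pow_mul]; congr 1; ring
      rw [e1]
      refine (ihP (M ^ 2)).trans ?_
      have e2 : M ^ 2 * (M ^ 2)ᵀ = (M * (M * Mᵀ)) * Mᵀ := by
        rw [pow_two, transpose_mul]; simp only [mul_assoc]
      rw [e2, aux_trace_pow_mul, ← mul_assoc]
      refine (ihR _ _ (by simp) (by simp)).trans ?_
      have h := aux_trace_mul_le ((Mᵀ * M) ^ 2 ^ k) ((M * Mᵀ) ^ 2 ^ k)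
      simp only [transpose_pow, transpose_mul, transpose_transpose] at h
      rw [← pow_add, ← pow_add, ← two_mul, ← pow_succ', aux_trace_pow_mul Mᵀ M] at h
      linarith
    · intro P Q hP hQ
      refine (ihP (P * Q)).trans ?_
      have e2 : P * Q * (P * Q)ᵀ = (P * Q ^ 2) * P := by
        rw [transpose_mul, hP, hQ, pow_two]; simp only [mul_assoc]
      rw [e2, aux_trace_pow_mul, ← mul_assoc, ← pow_two]
      refine (ihR _ _ (by simp [hP]) (by simp [hQ])).trans (le_of_eq ?_)
      rw [← pow_mul, ← pow_mul, ← pow_succ']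

attribute [local instance] Matrix.linftyOpNormedRing Matrix.linftyOpNormedAlgebra in
lemma aux_trotter_mat [Nonempty m] (A B : Matrix m m ℝ) :
    Tendsto (fun N : ℕ => (exp ((N:ℝ)⁻¹ • A) * exp ((N:ℝ)⁻¹ • B)) ^ N) atTop (𝓝 (exp (A + B))) :=
  haveI : NormOneClass (Matrix m m ℝ) := Matrix.linfty_opNormOneClass
  aux_trotter A B

lemma golden_thompson [Nonempty m] (A B : Matrix m m ℝ) (hA : Aᵀ = A) (hB : Bᵀ = B) :
    trace (exp (A + B)) ≤ trace (exp A * exp B) := by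
  have h := (aux_trotter_mat A B).comp (tendsto_pow_atTop_atTop_of_one_lt (r := 2) (by norm_num))
  have hc : Continuous fun M : Matrix m m ℝ => trace M := continuous_id.matrix_trace
  have h2 := (hc.tendsto _).comp h
  refine le_of_tendsto' h2 fun k => ?_
  simp only [Function.comp]
  refine ((aux_PR k).2 _ _ ?_ ?_).trans (le_of_eq ?_)
  · rw [← Matrix.exp_transpose, transpose_smul, hA]
  · rw [← Matrix.exp_transpose, transpose_smul, hB]
  · have : ((2 ^ k : ℕ) : ℝ) ≠ 0 := by positivity
    rw [← Matrix.exp_nsmul, ← Matrix.exp_nsmul, ← Nat.cast_smul_eq_nsmul ℝ, ← Nat.cast_smul_eq_nsmul ℝ, smul_smul, smul_smul,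
      mul_inv_cancel₀ this, one_smul, one_smul]

attribute [local instance] Matrix.linftyOpNormedRing Matrix.linftyOpNormedAlgebra in
lemma aux_exp_idem (P : Matrix m m ℝ) (hP : P * P = P) (c : ℝ) :
    exp (c • P) = 1 + (Real.exp c - 1) • P := by
  have h := exp_series_hasSum_exp' (𝕂 := ℝ) (c • P)
  have h2 := exp_series_hasSum_exp' (𝕂 := ℝ) c
  rw [← Real.exp_eq_exp_ℝ] at h2
  have h3 := (h2.smul_const P).add (hasSum_ite_eq (0:ℕ) (1 - P))
  have hp : ∀ n : ℕ, P ^ (n+1) = P := fun n => by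
    induction n with
    | zero => simp
    | succ n ih => rw [pow_succ, ih, hP]
  have h4 : HasSum (fun n : ℕ => ((n.factorial : ℝ)⁻¹) • (c • P) ^ n) (Real.exp c • P + (1 - P)) := by
    refine h3.congr_fun ?_ 
    intro n
    cases n with
    | zero => simp
    | succ n => simp [smul_pow, hp, smul_smul]
  refine (h.unique h4).trans ?_
  rw [sub_smul, one_smul]; abel

lemma aux_exp_trace_ge (S : Matrix m m ℝ) (hS : Sᵀ = S) (x : m → ℝ) (a : ℝ)
    (hx : 0 < ∑ i, x i ^ 2) (h : a * ∑ i, x i ^ 2 ≤ x ⬝ᵥ (S *ᵥ x)) :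
    Real.exp a ≤ trace (exp S) := by
  have hH : S.IsHermitian := by rw [IsHermitian, conjTranspose_eq_transpose_of_trivial, hS]
  set U : Matrix m m ℝ := (hH.eigenvectorUnitary : Matrix m m ℝ) with hU
  have hUU : U * star U = 1 := Unitary.coe_mul_star_self _
  have hUU' : star U * U = 1 := Unitary.coe_star_mul_self _
  have hinv : U⁻¹ = star U := inv_eq_right_inv hUU
  have hsp : S = U * diagonal hH.eigenvalues * star U := hH.spectral_theorem
  have hunit : IsUnit U := IsUnit.of_mul_eq_one _ hUU
  have htr : trace (exp S) = ∑ i, Real.exp (hH.eigenvalues i) := by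
    conv_lhs => rw [hsp]
    rw [← hinv, exp_conj _ _ hunit, trace_mul_comm, ← mul_assoc, hinv, hUU', one_mul, exp_diagonal, trace_diagonal]
    simp [Pi.coe_exp, Real.exp_eq_exp_ℝ]
  set y := star U *ᵥ x with hy
  have hstar : star U = Uᵀ := conjTranspose_eq_transpose_of_trivial U
  have hq : x ⬝ᵥ (S *ᵥ x) = ∑ i, hH.eigenvalues i * y i ^ 2 := by
    have : x ⬝ᵥ (S *ᵥ x) = y ⬝ᵥ (diagonal hH.eigenvalues *ᵥ y) := by
      conv_lhs => rw [hsp]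
      rw [← mulVec_mulVec, ← mulVec_mulVec, dotProduct_mulVec, ← hy]
      congr 1
      rw [hy, hstar, mulVec_transpose]
    rw [this]
    simp [dotProduct, mulVec_diagonal]
    exact Finset.sum_congr rfl fun i _ => by ring
  have hn : ∑ i, x i ^ 2 = ∑ i, y i ^ 2 := by
    have : x ⬝ᵥ x = y ⬝ᵥ y := by
      rw [hy]
      conv_rhs => rw [dotProduct_mulVec, hstar, vecMul_transpose, mulVec_mulVec, ← hstar, hUU, one_mulVec]
    simpa [dotProduct, pow_two] using this
  rw [htr]
  by_contra hlt
  push Not at hlt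
  have hall : ∀ i, hH.eigenvalues i < a := fun i => by
    rw [← Real.exp_lt_exp]
    refine lt_of_le_of_lt ?_ hlt
    exact Finset.single_le_sum (f := fun i => Real.exp (hH.eigenvalues i)) (fun _ _ => (Real.exp_pos _).le) (Finset.mem_univ i)
  rw [hq, hn, Finset.mul_sum] at h
  rw [hn] at hx
  obtain ⟨i, -, hi⟩ := Finset.exists_lt_of_sum_lt (s := Finset.univ) (f := fun _ : m => (0:ℝ)) (g := fun i => y i ^ 2) (by simpa using hx)
  refine absurd h (not_le.2 (Finset.sum_lt_sum (fun j _ => ?_) ⟨i, Finset.mem_univ _, ?_⟩))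
  · exact mul_le_mul_of_nonneg_right (hall j).le (sq_nonneg _)
  · exact mul_lt_mul_of_pos_right (hall i) hi
end GT

section expect
open Matrix
variable {ι α : Type*} [Fintype ι] [DecidableEq ι] [Fintype α]

lemma aux_resample (w : ι → α → ℝ) (hw : ∀ i, ∑ a, w i a = 1) (i : ι) (f : (ι → α) → ℝ) :
    ∑ d : ι → α, (∏ q, w q (d q)) * f d =
      ∑ d : ι → α, (∏ q, w q (d q)) * ∑ a, w i a * f (Function.update d i a) := by
  have h1 : ∑ d : ι → α, (∏ q, w q (d q)) * f d =
      ∑ z : (ι → α) × α, (∏ q, w q (z.1 q)) * f z.1 * w i z.2 := by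
    rw [Fintype.sum_prod_type]
    refine Finset.sum_congr rfl fun d _ => ?_
    dsimp only
    rw [← Finset.mul_sum, hw, mul_one]
  have h2 : ∑ d : ι → α, (∏ q, w q (d q)) * ∑ a, w i a * f (Function.update d i a) =
      ∑ z : (ι → α) × α, (∏ q, w q (z.1 q)) * (w i z.2 * f (Function.update z.1 i z.2)) := by
    rw [Fintype.sum_prod_type]
    refine Finset.sum_congr rfl fun d _ => ?_
    rw [Finset.mul_sum]
  rw [h1, h2]
  let φ : (ι → α) × α → (ι → α) × α := fun z => (Function.update z.1 i z.2, z.1 i)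
  have hφ : Function.Involutive φ := fun z => by simp [φ]
  refine Fintype.sum_equiv hφ.toPerm _ _ fun z => ?_
  simp only [Function.Involutive.coe_toPerm, φ, Function.update_idem, Function.update_eq_self]
  have e1 : ∏ q, w q (z.1 q) = w i (z.1 i) * ∏ q ∈ Finset.univ.erase i, w q (z.1 q) :=
    (Finset.mul_prod_erase _ _ (Finset.mem_univ i)).symm
  have e2 : ∏ q, w q (Function.update z.1 i z.2 q) = w i z.2 * ∏ q ∈ Finset.univ.erase i, w q (z.1 q) := by
    rw [← Finset.mul_prod_erase _ _ (Finset.mem_univ i), Function.update_self]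
    congr 1
    refine Finset.prod_congr rfl fun q hq => ?_
    rw [Function.update_of_ne (Finset.ne_of_mem_erase hq)]
  rw [e1, e2]; ring

lemma aux_master {m : Type*} [Fintype m] [DecidableEq m] [Nonempty m]
    (w : ι → α → ℝ) (hw0 : ∀ i a, 0 ≤ w i a) (hw : ∀ i, ∑ a, w i a = 1)
    (Y : ι → α → Matrix m m ℝ) (hY : ∀ i a, (Y i a)ᵀ = Y i a)
    (hE : ∀ i, ∑ a, w i a • exp (Y i a) = 1) (s : Finset ι) :
    ∑ d : ι → α, (∏ q, w q (d q)) * trace (exp (∑ q ∈ s, Y q (d q))) ≤ Fintype.card m := by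
  induction s using Finset.induction_on with
  | empty =>
    have : ∑ d : ι → α, (∏ q, w q (d q)) = 1 := by
      rw [← Fintype.prod_sum]; simp [hw]
    simp only [Finset.sum_empty, exp_zero, trace_one]
    rw [← Finset.sum_mul, this, one_mul]
  | insert i s hi ih =>
    rw [aux_resample w hw i]
    refine le_trans (Finset.sum_le_sum fun d _ => ?_) ih
    refine mul_le_mul_of_nonneg_left ?_ (Finset.prod_nonneg fun q _ => hw0 _ _)
    have e : ∀ a, ∑ q ∈ insert i s, Y q (Function.update d i a q) = ∑ q ∈ s, Y q (d q) + Y i a := fun a => by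
      rw [Finset.sum_insert hi, Function.update_self, add_comm]
      congr 1
      refine Finset.sum_congr rfl fun q hq => ?_
      rw [Function.update_of_ne (by rintro rfl; exact hi hq)]
    calc _ ≤ ∑ a, w i a * trace (exp (∑ q ∈ s, Y q (d q)) * exp (Y i a)) := by
          refine Finset.sum_le_sum fun a _ => mul_le_mul_of_nonneg_left ?_ (hw0 _ _)
          rw [e]
          refine golden_thompson _ _ ?_ (hY _ _)
          rw [transpose_sum]
          exact Finset.sum_congr rfl fun q _ => hY _ _
      _ = trace (exp (∑ q ∈ s, Y q (d q)) * ∑ a, w i a • exp (Y i a)) := by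
          rw [Finset.mul_sum, trace_sum]
          refine Finset.sum_congr rfl fun a _ => ?_
          rw [mul_smul_comm, trace_smul, smul_eq_mul]
      _ = _ := by rw [hE, mul_one]
end expect

section graph
open Matrix

noncomputable def pairProj {n : ℕ} (q : Pair n) : Matrix (Fin n) (Fin n) ℝ :=
  (1/2 : ℝ) • vecMulVec (Pi.single q.1.1 1 - Pi.single q.1.2 1) (Pi.single q.1.1 1 - Pi.single q.1.2 1)

lemma pairProj_symm {n : ℕ} (q : Pair n) : (pairProj q)ᵀ = pairProj q := by
  rw [pairProj, transpose_smul, transpose_vecMulVec]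

lemma pairProj_idem {n : ℕ} (q : Pair n) : pairProj q * pairProj q = pairProj q := by
  have h := q.2.ne
  rw [pairProj, smul_mul_smul_comm, vecMulVec_mul_vecMulVec]
  simp only [dotProduct_sub, dotProduct_single, Pi.sub_apply, Pi.single_eq_same,
    Pi.single_eq_of_ne h, Pi.single_eq_of_ne h.symm, vecMulVec_smul, smul_smul]
  norm_num

lemma pairProj_quad {n : ℕ} (q : Pair n) (x : Fin n → ℝ) :
    x ⬝ᵥ (pairProj q *ᵥ x) = (x q.1.1 - x q.1.2) ^ 2 / 2 := by
  rw [pairProj, smul_mulVec, vecMulVec_mulVec]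
  simp
  ring

lemma pair_sum {n : ℕ} (f : Fin n → Fin n → ℝ) (hs : ∀ i j, f i j = f j i) (h0 : ∀ i, f i i = 0) :
    2 * ∑ q : Pair n, f q.1.1 q.1.2 = ∑ i, ∑ j, f i j := by
  have h1 : ∑ q : Pair n, f q.1.1 q.1.2 = ∑ i, ∑ j, if i < j then f i j else 0 := by
    rw [← Fintype.sum_prod_type (f := fun z : Fin n × Fin n => if z.1 < z.2 then f z.1 z.2 else 0),
      ← Finset.sum_filter]
    exact (Finset.sum_subtype _ (by simp) (fun z : Fin n × Fin n => f z.1 z.2)).symm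
  have h2 : ∑ i, ∑ j, f i j = (∑ i, ∑ j, if i < j then f i j else 0) + ∑ i, ∑ j, if j < i then f i j else 0 := by
    rw [← Finset.sum_add_distrib]
    refine Finset.sum_congr rfl fun i _ => ?_
    rw [← Finset.sum_add_distrib]
    refine Finset.sum_congr rfl fun j _ => ?_
    rcases lt_trichotomy i j with h | h | h
    · simp [h, h.not_gt]
    · subst h; simp [h0]
    · simp [h, h.not_gt]
  rw [h2, Finset.sum_comm (f := fun i j => if j < i then f i j else 0), h1, two_mul]
  congr 1
  refine Finset.sum_congr rfl fun i _ => Finset.sum_congr rfl fun j _ => ?_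
  rw [hs]

lemma pair_sum_sq {n : ℕ} (x : Fin n → ℝ) (hx : ∑ i, x i = 0) :
    ∑ q : Pair n, (x q.1.1 - x q.1.2) ^ 2 = n * ∑ i, x i ^ 2 := by
  have h := pair_sum (fun i j => (x i - x j) ^ 2) (fun i j => by ring) (fun i => by ring)
  have : ∑ i, ∑ j, (x i - x j) ^ 2 = 2 * (n * ∑ i, x i ^ 2) := by
    have e : ∀ i, ∑ j, (x i - x j) ^ 2 = n * x i ^ 2 + ∑ j, x j ^ 2 := fun i => by
      have : ∀ j, (x i - x j) ^ 2 = x i ^ 2 - 2 * x i * x j + x j ^ 2 := fun j => by ring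
      simp only [this, Finset.sum_add_distrib, Finset.sum_sub_distrib, ← Finset.mul_sum, hx]
      simp
    simp only [e, Finset.sum_add_distrib, ← Finset.mul_sum]
    simp; ring
  linarith

/-- graph Laplacian form -/
noncomputable def lapQ {n : ℕ} (d : EdgeData n) (x : Fin n → ℝ) : ℝ :=
  ∑ q : Pair n, if (d q).isSome then (x q.1.1 - x q.1.2) ^ 2 else 0

lemma lapQ_nonneg {n : ℕ} (d : EdgeData n) (x : Fin n → ℝ) : 0 ≤ lapQ d x :=
  Finset.sum_nonneg fun q _ => by split_ifs <;> positivity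

lemma lapQ_le {n : ℕ} (d : EdgeData n) (x : Fin n → ℝ) (D : ℝ) (hD : ∀ i, (degree d i : ℝ) ≤ D) :
    lapQ d x ≤ 2 * D * ∑ i, x i ^ 2 := by
  have h1 : lapQ d x ≤ 2 * ∑ q : Pair n, ∑ i, if (q.1.1 = i ∨ q.1.2 = i) ∧ (d q).isSome then x i ^ 2 else 0 := by
    rw [lapQ, Finset.mul_sum]
    refine Finset.sum_le_sum fun q _ => ?_
    by_cases h : (d q).isSome
    · simp only [h, and_true, if_true]
      have hne := q.2.ne
      have : ∑ i, (if (q.1.1 = i ∨ q.1.2 = i) then x i ^ 2 else 0) = x q.1.1 ^ 2 + x q.1.2 ^ 2 := by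
        rw [← Finset.sum_filter]
        have : Finset.univ.filter (fun i => q.1.1 = i ∨ q.1.2 = i) = {q.1.1, q.1.2} := by
          ext i; simp [eq_comm]
        rw [this, Finset.sum_pair hne]
      rw [this]
      nlinarith [sq_nonneg (x q.1.1 + x q.1.2)]
    · simp [h]
  refine h1.trans ?_
  rw [Finset.sum_comm, mul_assoc]
  refine mul_le_mul_of_nonneg_left ?_ (by norm_num)
  rw [Finset.mul_sum]
  refine Finset.sum_le_sum fun i _ => ?_
  rw [← Finset.sum_filter, Finset.sum_const, nsmul_eq_mul]
  exact mul_le_mul_of_nonneg_right (hD i) (sq_nonneg _)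

lemma hessCoeff_false (F : ℝ → ℝ) (h0 : CondA0 F) (x : ℝ) :
    hessCoeff F x false = hessCoeff F (-x) true := by
  have e : (fun y => -Real.log (1 - F y)) = fun y => (fun z => -Real.log (F z)) (-y) := by
    funext y
    have := h0.2 (-y)
    rw [neg_neg] at this
    simp [this]
  simp only [hessCoeff, if_true, Bool.false_eq_true, if_false]
  rw [e]
  have e2 : deriv (fun y => (fun z => -Real.log (F z)) (-y)) = fun y => - deriv (fun z => -Real.log (F z)) (-y) := by
    funext y; exact deriv_comp_neg (f := fun z => -Real.log (F z)) y
  rw [e2, deriv.fun_neg, deriv_comp_neg (f := deriv fun z => -Real.log (F z)), neg_neg]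

lemma hessCoeff_lt (F : ℝ → ℝ) (κ : ℝ) (h0 : CondA0 F) (h2 : CondA2 F κ) (x : ℝ) (b : Bool) :
    hessCoeff F x b < κ := by
  cases b
  · rw [hessCoeff_false F h0]; simpa [hessCoeff] using h2.2.2.1 (-x)
  · simpa [hessCoeff] using h2.2.2.1 x

lemma hessCoeff_gt (F : ℝ → ℝ) (κ : ℝ) (h0 : CondA0 F) (h2 : CondA2 F κ) (x : ℝ) (hx : |x| ≤ 4) (b : Bool) :
    κ⁻¹ < hessCoeff F x b := by
  cases b
  · rw [hessCoeff_false F h0]; simpa [hessCoeff] using h2.2.2.2 (-x) (by rwa [abs_neg])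
  · simpa [hessCoeff] using h2.2.2.2 x hx

lemma hessQuad_le {n : ℕ} (F : ℝ → ℝ) (κ : ℝ) (h0 : CondA0 F) (h2 : CondA2 F κ) (d : EdgeData n) (v x : Fin n → ℝ) :
    hessQuad n F d v x ≤ κ * lapQ d x := by
  rw [hessQuad, lapQ, Finset.mul_sum]
  refine Finset.sum_le_sum fun q _ => ?_
  cases h : d q with
  | none => simp
  | some b =>
    simp only [Option.elim, Option.isSome, if_true]
    exact mul_le_mul_of_nonneg_right (hessCoeff_lt F κ h0 h2 _ _).le (sq_nonneg _)

lemma hessQuad_ge {n : ℕ} (F : ℝ → ℝ) (κ : ℝ) (h0 : CondA0 F) (h2 : CondA2 F κ) (d : EdgeData n) (v x : Fin n → ℝ)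
    (hv : ∀ i, |v i| ≤ 2) :
    κ⁻¹ * lapQ d x ≤ hessQuad n F d v x := by
  rw [hessQuad, lapQ, Finset.mul_sum]
  refine Finset.sum_le_sum fun q _ => ?_
  cases h : d q with
  | none => simp
  | some b =>
    simp only [Option.elim, Option.isSome, if_true]
    refine mul_le_mul_of_nonneg_right (hessCoeff_gt F κ h0 h2 _ ?_ _).le (sq_nonneg _)
    have a := abs_le.1 (hv q.1.1)
    have b := abs_le.1 (hv q.1.2)
    rw [abs_le]; constructor <;> linarith

noncomputable def Ymat {n : ℕ} (p : ℝ) (q : Pair n) (a : Option Bool) : Matrix (Fin n) (Fin n) ℝ :=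
  ((if a.isSome then Real.log (1/2) else 0) - Real.log (1 - p/2)) • pairProj q

lemma Ymat_symm {n : ℕ} (p : ℝ) (q : Pair n) (a : Option Bool) : (Ymat p q a)ᵀ = Ymat p q a := by
  rw [Ymat, transpose_smul, pairProj_symm]

lemma Ymat_exp {n : ℕ} (p : ℝ) (hp : p ≤ 1) (q : Pair n) (w : Option Bool → ℝ)
    (hn : w none = 1 - p) (hw : ∑ a, w a = 1) : ∑ a, w a • exp (Ymat p q a) = 1 := by
  have hpos : 0 < 1 - p/2 := by linarith
  simp only [Ymat, aux_exp_idem _ (pairProj_idem q), Fintype.sum_option, Fintype.sum_bool] at hw ⊢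
  simp only [Option.isSome, if_true, Bool.false_eq_true, if_false, Real.exp_sub, Real.exp_log hpos,
    Real.exp_log (show (0:ℝ) < 1/2 by norm_num), Real.exp_zero]
  have e : w (some true) = p - w (some false) := by linarith
  have hne : 2 - p ≠ 0 := by linarith
  rw [hn, e]
  ext i j
  simp only [Matrix.add_apply, Matrix.smul_apply, smul_eq_mul]
  field_simp
  ring

lemma Ymat_quad {n : ℕ} (p : ℝ) (hp0 : 0 < p) (hp : p ≤ 1) (d : EdgeData n) (x : Fin n → ℝ) (hx : ∑ i, x i = 0)
    (hb : lapQ d x < n * p / 2 * ∑ i, x i ^ 2) :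
    n * p / 14 * ∑ i, x i ^ 2 ≤ x ⬝ᵥ ((∑ q, Ymat p q (d q)) *ᵥ x) := by
  have hpos : 0 < 1 - p/2 := by linarith
  have e : x ⬝ᵥ ((∑ q, Ymat p q (d q)) *ᵥ x) =
      -(Real.log 2 / 2) * lapQ d x + (-Real.log (1 - p/2)) / 2 * (n * ∑ i, x i ^ 2) := by
    rw [sum_mulVec, dotProduct_sum, ← pair_sum_sq x hx, lapQ, Finset.mul_sum, Finset.mul_sum,
      ← Finset.sum_add_distrib]
    refine Finset.sum_congr rfl fun q _ => ?_
    rw [Ymat, smul_mulVec, dotProduct_smul, pairProj_quad, one_div, Real.log_inv, smul_eq_mul]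
    split_ifs <;> ring
  have hlog : p / 2 ≤ -Real.log (1 - p/2) := by
    have := Real.log_le_sub_one_of_pos hpos
    linarith
  have h2 := Real.log_two_lt_d9
  have h20 := Real.log_two_gt_d9
  have hX : 0 ≤ ∑ i, x i ^ 2 := Finset.sum_nonneg fun i _ => sq_nonneg _
  have hnX : 0 ≤ n * ∑ i, x i ^ 2 := by positivity
  have hpX : 0 ≤ p * (n * ∑ i, x i ^ 2) := by positivity
  rw [e]
  have a1 := mul_le_mul_of_nonneg_right hlog hnX
  have a2 := mul_le_mul_of_nonneg_left hb.le (show 0 ≤ Real.log 2 / 2 by linarith)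
  have a3 := mul_le_mul_of_nonneg_right h2.le hpX
  nlinarith
end graph

section prob
open Matrix

lemma aux_tail {n : ℕ} (hn : 0 < n) (p : ℝ) (hp0 : 0 < p) (hp : p ≤ 1)
    (w : Pair n → Option Bool → ℝ) (hw0 : ∀ q a, 0 ≤ w q a) (hw : ∀ q, ∑ a, w q a = 1)
    (hnone : ∀ q, w q none = 1 - p) (s : Finset (EdgeData n))
    (hs : ∀ d ∈ s, ∃ x : Fin n → ℝ, ∑ i, x i = 0 ∧ lapQ d x < n * p / 2 * ∑ i, x i ^ 2) :
    ∑ d ∈ s, ∏ q, w q (d q) ≤ n * Real.exp (-(n * p / 14)) := by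
  have : Nonempty (Fin n) := ⟨⟨0, hn⟩⟩
  have h1 := aux_master (m := Fin n) w hw0 hw (fun q a => Ymat p q a) (fun q a => Ymat_symm p q a)
    (fun q => Ymat_exp p hp q (w q) (hnone q) (hw q)) Finset.univ
  rw [Fintype.card_fin] at h1
  have hsym : ∀ d : EdgeData n, (∑ q, Ymat p q (d q))ᵀ = ∑ q, Ymat p q (d q) := fun d => by
    rw [transpose_sum]
    exact Finset.sum_congr rfl fun q _ => Ymat_symm _ _ _
  have hW : ∀ d : EdgeData n, 0 ≤ ∏ q, w q (d q) := fun d => Finset.prod_nonneg fun q _ => hw0 _ _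
  have htr : ∀ d : EdgeData n, 0 ≤ trace (exp (∑ q, Ymat p q (d q))) := fun d => by
    -- use a coordinate vector and a very negative lower bound
    set S := ∑ q, Ymat p q (d q)
    have := aux_exp_trace_ge S (hsym d) (Pi.single ⟨0, hn⟩ 1)
      ((Pi.single ⟨0, hn⟩ 1 : Fin n → ℝ) ⬝ᵥ (S *ᵥ (Pi.single ⟨0, hn⟩ 1))) (by simp [Pi.single_apply])
      (by simp [Pi.single_apply])
    exact (Real.exp_pos _).le.trans this
  have h2 : (∑ d ∈ s, ∏ q, w q (d q)) * Real.exp (n * p / 14) ≤ n := by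
    refine le_trans ?_ h1
    rw [Finset.sum_mul]
    refine le_trans (Finset.sum_le_sum fun d hd => ?_) (Finset.sum_le_sum_of_subset_of_nonneg
      (Finset.subset_univ s) fun d _ _ => mul_nonneg (hW d) (htr d))
    refine mul_le_mul_of_nonneg_left ?_ (hW d)
    obtain ⟨x, hx, hb⟩ := hs d hd
    refine aux_exp_trace_ge _ (hsym d) x _ ?_ (Ymat_quad p hp0 hp d x hx hb)
    by_contra hneg
    have h0 : ∑ i, x i ^ 2 = 0 := le_antisymm (not_lt.1 hneg) (Finset.sum_nonneg fun i _ => sq_nonneg _)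
    rw [h0, mul_zero] at hb
    exact absurd hb (not_lt.2 (lapQ_nonneg d x))
  rw [Real.exp_neg, ← div_eq_mul_inv, le_div_iff₀ (Real.exp_pos _)]
  exact h2

lemma aux_weights {n : ℕ} {p : ℝ} {F : ℝ → ℝ} {θ : Fin n → ℝ} (hp : p ≤ 1)
    {Ω : Type} [MeasurableSpace Ω] (μ : Measure Ω) [IsProbabilityMeasure μ]
    (data : Ω → EdgeData n) (hd : IsParamModel μ n p F θ data) :
    ∃ w : Pair n → Option Bool → ℝ, (∀ q a, 0 ≤ w q a) ∧ (∀ q, ∑ a, w q a = 1) ∧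
      (∀ q, w q none = 1 - p) ∧ ∀ d, μ {ω | data ω = d} = ENNReal.ofReal (∏ q, w q (d q)) := by
  set w : Pair n → Option Bool → ℝ := fun q a => max (pairWeight p (F (θ q.1.1 - θ q.1.2)) a) 0 with hwdef
  have hw0 : ∀ q a, 0 ≤ w q a := fun q a => le_max_right _ _
  have hnone : ∀ q, w q none = 1 - p := fun q => max_eq_left (by simp [pairWeight]; linarith)
  have hμ : ∀ d, μ {ω | data ω = d} = ENNReal.ofReal (∏ q, w q (d q)) := fun d => by
    rw [hd.2 d, ENNReal.ofReal_prod_of_nonneg fun q _ => hw0 _ _]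
    refine Finset.prod_congr rfl fun q _ => ?_
    simp [hwdef]
  refine ⟨w, hw0, ?_, hnone, hμ⟩
  have hge : ∀ q, 1 ≤ ∑ a, w q a := fun q => by
    rw [Fintype.sum_option, Fintype.sum_bool, hnone]
    have h1 : p * F (θ q.1.1 - θ q.1.2) ≤ w q (some true) := le_max_left _ _
    have h2 : p * (1 - F (θ q.1.1 - θ q.1.2)) ≤ w q (some false) := le_max_left _ _
    linarith
  have htot : ∏ q, ∑ a, w q a = 1 := by
    have : MeasurableSingletonClass (Option Bool) := ⟨fun _ => trivial⟩
    have h := sum_measure_preimage_singleton (μ := μ) (f := data) (Finset.univ)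
      (fun d _ => hd.1 (measurableSet_singleton d))
    have h' : ∑ d : EdgeData n, ENNReal.ofReal (∏ q, w q (d q)) = 1 := by
      rw [← (measure_univ : μ Set.univ = 1)]
      simp only [Finset.coe_univ, Set.preimage_univ] at h
      rw [← h]
      exact Finset.sum_congr rfl fun d _ => (hμ d).symm
    rw [← ENNReal.ofReal_sum_of_nonneg (fun d _ => Finset.prod_nonneg fun q _ => hw0 _ _),
      ENNReal.ofReal_eq_one] at h'
    rw [Fintype.prod_sum]
    exact h'
  intro q
  by_contra hne
  have hlt : 1 < ∑ a, w q a := lt_of_le_of_ne (hge q) (Ne.symm hne)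
  have := Finset.prod_lt_prod (s := Finset.univ) (f := fun _ : Pair n => (1:ℝ)) (g := fun q => ∑ a, w q a)
    (fun _ _ => one_pos) (fun q _ => hge q) ⟨q, Finset.mem_univ _, hlt⟩
  rw [htot] at this
  simp at this
end prob

end helpers

/-- Lemma 3: spectrum of the likelihood Hessian.
There are universal constants `c, C' > 0` such that under the parametric model with
`F` satisfying (A0), (A2), `‖θ*‖_∞ ≤ 1`, and `p ≥ c log n/n`, the following holds.
Except on a set of probability at most `C' n⁻¹⁰`, on the event
`A₀ = {np/2 ≤ d_min(G) ≤ d_max(G) ≤ 3np/2}` one has, simultaneously for all `v` with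
`‖v - θ*‖_∞ ≤ 1`: `λ_max(∇²L(v)) ≤ 3κ₂ np` (every Rayleigh quotient is at most
`3κ₂ np`), and `λ₂(∇²L(v)) ≥ np/(2κ₂)` (the Rayleigh quotient on the subspace
`{x : 1ᵀx = 0}` orthogonal to the kernel direction `1` is at least `np/(2κ₂)`). -/
theorem statement17 : ∃ c C' : ℝ, 0 < c ∧ 0 < C' ∧
    ∀ (n : ℕ) (F : ℝ → ℝ) (κ₂ p : ℝ) (θstar : Fin n → ℝ),
      CondA0 F → CondA2 F κ₂ → (∀ i, |θstar i| ≤ 1) →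
      0 < p → p ≤ 1 → c * Real.log n / n ≤ p →
    ∀ (Ω : Type) (_ : MeasurableSpace Ω) (μ : Measure Ω), IsProbabilityMeasure μ →
    ∀ data : Ω → EdgeData n, IsParamModel μ n p F θstar data →
      μ {ω |
          (∀ i, n * p / 2 ≤ (degree (data ω) i : ℝ) ∧
            (degree (data ω) i : ℝ) ≤ 3 * n * p / 2) ∧
          ¬ (∀ v : Fin n → ℝ, (∀ i, |v i - θstar i| ≤ 1) →
              (∀ x : Fin n → ℝ,
                hessQuad n F (data ω) v x ≤ 3 * κ₂ * (n * p) * ∑ i, x i ^ 2) ∧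
              (∀ x : Fin n → ℝ, (∑ i, x i) = 0 →
                n * p / (2 * κ₂) * ∑ i, x i ^ 2 ≤ hessQuad n F (data ω) v x))} ≤
        ENNReal.ofReal (C' / n ^ 10) := by
  classical
  refine ⟨154, 1, by norm_num, one_pos, ?_⟩
  intro n F κ p θ h0 h2 hθ hp0 hp hc Ω _ μ hμ data hd
  have hκ := h2.1
  rcases Nat.eq_zero_or_pos n with hn | hn
  · subst hn
    refine le_of_eq_of_le ?_ zero_le
    convert measure_empty (μ := μ)
    rw [Set.eq_empty_iff_forall_notMem]
    rintro ω ⟨-, hno⟩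
    refine hno fun v _ => ⟨fun x => ?_, fun x _ => ?_⟩ <;> simp [hessQuad]
  obtain ⟨w, hw0, hw, hnone, hμw⟩ := aux_weights hp μ data hd
  set s : Finset (EdgeData n) := Finset.univ.filter fun d =>
    ∃ x : Fin n → ℝ, ∑ i, x i = 0 ∧ lapQ d x < n * p / 2 * ∑ i, x i ^ 2 with hs
  have htail := aux_tail hn p hp0 hp w hw0 hw hnone s (fun d hd => (Finset.mem_filter.1 hd).2)
  have hnR : (0:ℝ) < n := by exact_mod_cast hn
  have hnum : (n:ℝ) * Real.exp (-(n * p / 14)) ≤ 1 / n ^ 10 := by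
    have h11 : 11 * Real.log n ≤ n * p / 14 := by
      rw [div_le_iff₀ hnR] at hc
      linarith
    have : Real.exp (-(n * p / 14)) ≤ ((n:ℝ) ^ 11)⁻¹ := by
      rw [Real.exp_neg]
      refine inv_anti₀ (by positivity) ?_
      rw [← Real.exp_log (show (0:ℝ) < (n:ℝ) ^ 11 by positivity), Real.log_pow]
      exact Real.exp_le_exp.2 (by exact_mod_cast h11)
    calc (n:ℝ) * Real.exp (-(n * p / 14)) ≤ n * ((n:ℝ) ^ 11)⁻¹ := by gcongr
      _ = 1 / n ^ 10 := by field_simp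
  calc _ ≤ μ (⋃ d ∈ s, {ω | data ω = d}) := by
        refine measure_mono ?_
        rintro ω ⟨hdeg, hno⟩
        simp only [Set.mem_iUnion, Set.mem_ofPred_eq, exists_prop, exists_eq_right']
        by_contra hns
        refine hno fun v hv => ⟨fun x => ?_, fun x hx => ?_⟩
        · refine (hessQuad_le F κ h0 h2 _ v x).trans ?_
          have := mul_le_mul_of_nonneg_left (lapQ_le (data ω) x _ fun i => (hdeg i).2) hκ.le
          refine this.trans (le_of_eq ?_)
          ring
        · refine le_trans ?_ (hessQuad_ge F κ h0 h2 _ v x fun i => ?_)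
          · have hq : n * p / 2 * ∑ i, x i ^ 2 ≤ lapQ (data ω) x := by
              by_contra hlt
              exact hns (Finset.mem_filter.2 ⟨Finset.mem_univ _, x, hx, not_le.1 hlt⟩)
            have := mul_le_mul_of_nonneg_left hq (inv_nonneg.2 hκ.le)
            refine le_trans (le_of_eq ?_) this
            field_simp
          · have a := abs_le.1 (hv i)
            have b := abs_le.1 (hθ i)
            rw [abs_le]; constructor <;> linarith
    _ ≤ ∑ d ∈ s, μ {ω | data ω = d} := measure_biUnion_finset_le _ _
    _ = ENNReal.ofReal (∑ d ∈ s, ∏ q, w q (d q)) := by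
        rw [ENNReal.ofReal_sum_of_nonneg fun d _ => Finset.prod_nonneg fun q _ => hw0 _ _]
        exact Finset.sum_congr rfl fun d _ => hμw d
    _ ≤ _ := ENNReal.ofReal_le_ofReal (htail.trans hnum)

end PrivateRanking
end

section
/- Let θ̃^t be the gradient descent iterates θ̃^{t+1} = θ̃^t − η(∇L(θ̃^t) + γ θ̃^t + w) with step size η = (γ + 3κ₂np)^{−1}, initialized at θ̃⁰ = θ* with 1ᵀθ* = 0, where w = (W₁,…,W_n) is a fixed noise vector. Then on the event {|1ᵀw| ≤ 8λ√(n log n)}, it holds for every t ∈ ℕ that |1ᵀθ̃^t| ≤ 8λ√(n log n)/γ. -/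
open MeasureTheory ProbabilityTheory
open scoped ENNReal

namespace PrivateRanking

/-- Lemma 4: the coordinate sum of the perturbed gradient-descent
iterates stays small.  Let `θ̃^t` be the gradient descent iterates
`θ̃^{t+1} = θ̃^t - η (∇L(θ̃^t) + γ θ̃^t + w)` with step size `η = (γ + 3κ₂ n p)⁻¹`,
initialized at `θ̃⁰ = θ*` with `1ᵀθ* = 0`, for a fixed noise vector `w`.  If
`|1ᵀw| ≤ 8λ√(n log n)`, then `|1ᵀθ̃^t| ≤ 8λ√(n log n)/γ` for every `t`. -/
theorem statement18 (n : ℕ) (F : ℝ → ℝ) (d : EdgeData n)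
    (γ κ₂ p lam η : ℝ) (w θstar : Fin n → ℝ)
    (hγ : 0 < γ) (hκ₂ : 0 < κ₂) (hp : 0 ≤ p) (hlam : 0 < lam)
    (hη : η = (γ + 3 * κ₂ * (n * p))⁻¹)
    (hcenter : ∑ i, θstar i = 0)
    (seq : ℕ → Fin n → ℝ)
    (hinit : seq 0 = θstar)
    (hrec : ∀ t, seq (t + 1) =
      fun i => seq t i - η * (gradNll n F (seq t) d i + γ * seq t i + w i))
    (hw : |∑ i, w i| ≤ 8 * lam * Real.sqrt (n * Real.log n)) :
    ∀ t : ℕ, |∑ i, seq t i| ≤ 8 * lam * Real.sqrt (n * Real.log n) / γ := by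
  have hg : ∀ v : Fin n → ℝ, ∑ i, gradNll n F v d i = 0 := by
    intro v
    unfold gradNll
    rw [Finset.sum_comm]
    refine Finset.sum_eq_zero fun q _ => ?_
    cases d q with
    | none => simp
    | some b => simp [← Finset.mul_sum, Finset.sum_sub_distrib]
  have hden : γ ≤ γ + 3 * κ₂ * (n * p) := by
    have : 0 ≤ 3 * κ₂ * (n * p) := by positivity
    linarith
  have hη0 : 0 ≤ η := by rw [hη]; exact inv_nonneg.mpr (hγ.le.trans hden)
  have hη1 : η * γ ≤ 1 := by
    rw [hη, inv_mul_le_iff₀ (lt_of_lt_of_le hγ hden)]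
    linarith
  set B := 8 * lam * Real.sqrt (n * Real.log n) with hB
  have hB0 : 0 ≤ B := by positivity
  intro t
  induction t with
  | zero =>
    rw [hinit, hcenter, abs_zero]
    positivity
  | succ t ih =>
    have hs : ∑ i, seq (t + 1) i = (1 - η * γ) * ∑ i, seq t i - η * ∑ i, w i := by
      rw [hrec t]
      simp only [Finset.sum_sub_distrib, ← Finset.mul_sum, Finset.sum_add_distrib, hg]
      ring
    rw [hs]
    calc |(1 - η * γ) * ∑ i, seq t i - η * ∑ i, w i|
        ≤ |(1 - η * γ) * ∑ i, seq t i| + |η * ∑ i, w i| := abs_sub _ _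
      _ = (1 - η * γ) * |∑ i, seq t i| + η * |∑ i, w i| := by
          rw [abs_mul, abs_mul, abs_of_nonneg hη0, abs_of_nonneg (sub_nonneg.mpr hη1)]
      _ ≤ (1 - η * γ) * (B / γ) + η * B :=
          add_le_add (mul_le_mul_of_nonneg_left ih (sub_nonneg.mpr hη1))
            (mul_le_mul_of_nonneg_left hw hη0)
      _ = B / γ := by field_simp; ring

end PrivateRanking
end
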